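/- Let μ be an integrable probability measure on ℝ^d and α ∈ (0,1]. Then the metronoid of the measure α^{-1}μ equals the average quantile set of μ: Met(α^{-1}μ) = E_α(μ); equivalently, for every u ∈ ℝ^d, sup{∫⟨x,u⟩ f(x) α^{-1}μ(dx) : f : ℝ^d → [0,1] measurable, ∫ f d(α^{-1}μ) = 1} = e_α(⟨ξ,u⟩), where ξ has distribution μ. -/

import Mathlib

open MeasureTheory RealInnerProductSpace

/-- The `t`-quantile of a distribution `ν` on `ℝ`: `q_t = inf {s : ν(-∞,s] ≥ t}`. -/
noncomputable def quantile (ν : Measure ℝ) (t : ℝ) : ℝ :=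
  sInf {s : ℝ | t ≤ (ν (Set.Iic s)).toReal}

/-- The average quantile `e_α(β) = α⁻¹ ∫_{1−α}^1 q_t(β) dt` of a distribution `ν` on `ℝ`. -/
noncomputable def avgQuantile (ν : Measure ℝ) (α : ℝ) : ℝ :=
  α⁻¹ * ∫ t in Set.Ioc (1 - α) 1, quantile ν t

/-- The metronoid of a Borel measure `ν` on `ℝ^d`:
`Met(ν) = {∫ x f(x) ν(dx) : f : ℝ^d → [0,1] measurable, ∫ x f(x) ν(dx) exists,
∫ f dν = 1}`. -/
def metronoid {d : ℕ} (ν : Measure (EuclideanSpace ℝ (Fin d))) :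
    Set (EuclideanSpace ℝ (Fin d)) :=
  {y | ∃ f : EuclideanSpace ℝ (Fin d) → ℝ, Measurable f ∧
    (∀ x, f x ∈ Set.Icc (0:ℝ) 1) ∧ Integrable (fun x => f x • x) ν ∧
    (∫ x, f x ∂ν) = 1 ∧ y = ∫ x, f x • x ∂ν}

/-- The average quantile set `E_α(μ)` of a probability measure `μ` on `ℝ^d`: the convex
closed set with support function `u ↦ e_α(⟨ξ,u⟫)` for `ξ` distributed according to `μ`. -/
def avgQuantileSet {d : ℕ} (μ : Measure (EuclideanSpace ℝ (Fin d))) (α : ℝ) :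
    Set (EuclideanSpace ℝ (Fin d)) :=
  {x | ∀ u : EuclideanSpace ℝ (Fin d),
    ⟪x, u⟫ ≤ avgQuantile (Measure.map (fun v => ⟪v, u⟫) μ) α}

theorem ae_norm_le_one_of_mem_Icc {X : Type*} [MeasurableSpace X] {m : Measure X} {f : X → ℝ}
    (hf : ∀ x, f x ∈ Set.Icc (0 : ℝ) 1) : ∀ᵐ x ∂m, ‖f x‖ ≤ 1 :=
  .of_forall fun x => by
    rw [Real.norm_of_nonneg (hf x).1]
    exact (hf x).2

theorem exists_unitInterval_valued_of_setIntegral_bounds {X : Type*} [MeasurableSpace X]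
    {m : Measure X} [IsFiniteMeasure m] {h : X → ℝ} (hh : Integrable h m)
    (h0 : ∀ s, MeasurableSet s → 0 ≤ ∫ x in s, h x ∂m)
    (h1 : ∀ s, MeasurableSet s → ∫ x in s, h x ∂m ≤ m.real s) :
    ∃ f : X → ℝ, Measurable f ∧ (∀ x, f x ∈ Set.Icc (0 : ℝ) 1) ∧ f =ᵐ[m] h := by
  have hnonneg : 0 ≤ᵐ[m] h :=
    ae_nonneg_of_forall_setIntegral_nonneg hh fun s hs _ => h0 s hs
  have hle : h ≤ᵐ[m] fun _ => (1 : ℝ) :=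
    ae_le_of_forall_setIntegral_le hh (integrable_const _) fun s hs _ => by
      simpa using h1 s hs
  refine ⟨fun x => max 0 (min 1 (hh.aestronglyMeasurable.mk h x)), ?_, fun x => ?_, ?_⟩
  · exact measurable_const.max
      (measurable_const.min hh.aestronglyMeasurable.stronglyMeasurable_mk.measurable)
  · exact ⟨le_max_left _ _, max_le zero_le_one (min_le_left _ _)⟩
  · filter_upwards [hnonneg, hle, hh.aestronglyMeasurable.ae_eq_mk] with x hx0 hx1 hx
    rw [← hx, min_eq_right hx1]
    exact max_eq_right hx0

theorem isCompact_setOf_integral_mul_of_memLp_two {X ι : Type*} [MeasurableSpace X]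
    (m : Measure X) [IsFiniteMeasure m] {g : ι → X → ℝ} (hg : ∀ i, MemLp (g i) 2 m) :
    IsCompact {v : ι → ℝ | ∃ f : X → ℝ, Measurable f ∧ (∀ x, f x ∈ Set.Icc (0 : ℝ) 1) ∧
      ∀ i, v i = ∫ x, f x * g i x ∂m} := by
  let K : Set (WeakDual ℝ (Lp ℝ 2 m)) := {L | ∀ (s : Set X) (hs : MeasurableSet s),
    L (indicatorConstLp 2 hs (measure_ne_top m s) (1 : ℝ)) ∈ Set.Icc 0 (m.real s)}
  have hrepr : ∀ L ∈ K, ∃ f : X → ℝ, ∃ hf : MemLp f 2 m, Measurable f ∧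
      (∀ x, f x ∈ Set.Icc (0 : ℝ) 1) ∧
      WeakDual.toStrongDual L = InnerProductSpace.toDual ℝ (Lp ℝ 2 m) (hf.toLp f) := by
    intro L hL
    set h : Lp ℝ 2 m := (InnerProductSpace.toDual ℝ (Lp ℝ 2 m)).symm (WeakDual.toStrongDual L)
      with h_def
    have hLh : WeakDual.toStrongDual L = InnerProductSpace.toDual ℝ (Lp ℝ 2 m) h := by
      rw [h_def, LinearIsometryEquiv.apply_symm_apply]
    have hset : ∀ s (hs : MeasurableSet s),
        L (indicatorConstLp 2 hs (measure_ne_top m s) (1 : ℝ)) = ∫ x in s, h x ∂m := by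
      intro s hs
      rw [← L2.inner_indicatorConstLp_one (𝕜 := ℝ) hs (measure_ne_top m s) h,
        real_inner_comm, ← InnerProductSpace.toDual_apply_apply, ← hLh]
      rfl
    obtain ⟨f, hf, hf01, hfh⟩ := exists_unitInterval_valued_of_setIntegral_bounds
      ((Lp.memLp h).integrable (by norm_num))
      (fun s hs => hset s hs ▸ (hL s hs).1) (fun s hs => hset s hs ▸ (hL s hs).2)
    have hfm : MemLp f 2 m := (memLp_congr_ae hfh).2 (Lp.memLp h)
    refine ⟨f, hfm, hf, hf01, hLh.trans (congrArg _ ?_)⟩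
    exact Lp.ext (hfh.symm.trans hfm.coeFn_toLp.symm)
  have heval : ∀ {f : X → ℝ} (hf : MemLp f 2 m) {k : X → ℝ} (hk : MemLp k 2 m),
      InnerProductSpace.toDual ℝ (Lp ℝ 2 m) (hf.toLp f) (hk.toLp k) = ∫ x, f x * k x ∂m := by
    intro f hf k hk
    rw [InnerProductSpace.toDual_apply_apply, L2.inner_def]
    refine integral_congr_ae ?_
    filter_upwards [hf.coeFn_toLp, hk.coeFn_toLp] with x hx hx'
    rw [hx, hx']
    simp [mul_comm]
  have hclosed : IsClosed K := by
    simp only [K, Set.ofPred_forall]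
    exact isClosed_iInter fun s => isClosed_iInter fun hs =>
      isClosed_Icc.preimage (WeakDual.eval_continuous _)
  have hbounded : Bornology.IsBounded K := by
    refine Bornology.IsBounded.subset (WeakDual.isBounded_closedBall 0
      (m.real Set.univ ^ (2 : ENNReal).toReal⁻¹ * 1)) fun L hL => ?_
    obtain ⟨f, hfm, hf, hf01, hLf⟩ := hrepr L hL
    rw [Set.mem_preimage, mem_closedBall_zero_iff, hLf, LinearIsometryEquiv.norm_map]
    refine Lp.norm_le_of_ae_bound zero_le_one ?_
    filter_upwards [hfm.coeFn_toLp] with x hx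
    rw [hx, Real.norm_of_nonneg (hf01 x).1]
    exact (hf01 x).2
  have hcont : Continuous fun (L : WeakDual ℝ (Lp ℝ 2 m)) (i : ι) => L ((hg i).toLp (g i)) :=
    continuous_pi fun i => WeakDual.eval_continuous _
  convert (WeakDual.isCompact_of_bounded_of_closed hbounded hclosed).image hcont using 1
  ext v
  constructor
  · rintro ⟨f, hf, hf01, hv⟩
    have hfm : MemLp f 2 m := MemLp.of_bound hf.aestronglyMeasurable 1
      (ae_norm_le_one_of_mem_Icc hf01)
    refine ⟨StrongDual.toWeakDual (InnerProductSpace.toDual ℝ (Lp ℝ 2 m) (hfm.toLp f)),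
      fun s hs => ?_, funext fun i => (heval hfm (hg i)).trans (hv i).symm⟩
    have hval : ∫ x in s, f x ∂m = InnerProductSpace.toDual ℝ (Lp ℝ 2 m) (hfm.toLp f)
        (indicatorConstLp 2 hs (measure_ne_top m s) (1 : ℝ)) := by
      rw [InnerProductSpace.toDual_apply_apply, real_inner_comm, L2.inner_indicatorConstLp_one]
      exact integral_congr_ae (ae_restrict_of_ae hfm.coeFn_toLp.symm)
    change InnerProductSpace.toDual ℝ (Lp ℝ 2 m) (hfm.toLp f) _ ∈ _
    rw [← hval]
    refine ⟨integral_nonneg fun x => (hf01 x).1, ?_⟩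
    calc ∫ x in s, f x ∂m ≤ ∫ x in s, (1 : ℝ) ∂m :=
          integral_mono (hfm.integrable (by norm_num)).integrableOn (integrable_const _)
            fun x => (hf01 x).2
      _ = m.real s := by simp
  · rintro ⟨L, hL, rfl⟩
    obtain ⟨f, hfm, hf, hf01, hLf⟩ := hrepr L hL
    refine ⟨f, hf, hf01, fun i => ?_⟩
    rw [← heval hfm (hg i), ← hLf]
    rfl

theorem isCompact_setOf_integral_mul {X ι : Type*} [MeasurableSpace X] [Fintype ι]
    (m : Measure X) [IsFiniteMeasure m] {g : ι → X → ℝ} (hg : ∀ i, Measurable (g i))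
    (hgi : ∀ i, Integrable (g i) m) :
    IsCompact {v : ι → ℝ | ∃ f : X → ℝ, Measurable f ∧ (∀ x, f x ∈ Set.Icc (0 : ℝ) 1) ∧
      ∀ i, v i = ∫ x, f x * g i x ∂m} := by
  set w : X → ℝ := fun x => 1 + ∑ i, |g i x| with w_def
  have hw : Measurable w :=
    measurable_const.add (Finset.measurable_sum _ fun i _ => (hg i).abs)
  have hwi : Integrable w m :=
    (integrable_const 1).add (integrable_finsetSum _ fun i _ => (hgi i).abs)
  have hw1 : ∀ x, 1 ≤ w x := fun x =>
    le_add_of_nonneg_right (Finset.sum_nonneg fun i _ => abs_nonneg _)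
  have hw0 : ∀ x, 0 < w x := fun x => zero_lt_one.trans_le (hw1 x)
  have hgw : ∀ i x, |g i x| ≤ w x := fun i x =>
    (Finset.single_le_sum (f := fun i => |g i x|) (fun i _ => abs_nonneg _)
      (Finset.mem_univ i)).trans (le_add_of_nonneg_left zero_le_one)
  have := isFiniteMeasure_withDensity_ofReal hwi.2
  have key := isCompact_setOf_integral_mul_of_memLp_two
    (m.withDensity fun x => ENNReal.ofReal (w x)) (g := fun i x => g i x / w x) fun i =>
      MemLp.of_bound ((hg i).div hw).aestronglyMeasurable 1 <| .of_forall fun x => by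
        rw [Real.norm_eq_abs, abs_div, abs_of_pos (hw0 x), div_le_one (hw0 x)]
        exact hgw i x
  convert key using 7 with v f
  refine forall_congr' fun i => ?_
  rw [integral_withDensity_eq_integral_toReal_smul hw.ennreal_ofReal
    (.of_forall fun x => ENNReal.ofReal_lt_top)]
  refine iff_of_eq (congrArg _ (integral_congr_ae (.of_forall fun x => ?_)))
  have := (hw0 x).ne'
  simp only [ENNReal.toReal_ofReal (hw0 x).le, smul_eq_mul]
  field_simp

theorem isCompact_metronoid {d : ℕ} (ν : Measure (EuclideanSpace ℝ (Fin d)))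
    [IsFiniteMeasure ν] (hν : Integrable (fun x => x) ν) : IsCompact (metronoid ν) := by
  let g : Option (Fin d) → EuclideanSpace ℝ (Fin d) → ℝ := fun i x => i.elim 1 fun j => x j
  have hproj : ∀ (j : Fin d) {h : EuclideanSpace ℝ (Fin d) → EuclideanSpace ℝ (Fin d)},
      Integrable h ν → Integrable (fun x => h x j) ν ∧ (∫ x, h x ∂ν) j = ∫ x, h x j ∂ν :=
    fun j h hh => ⟨(EuclideanSpace.proj (𝕜 := ℝ) j).integrable_comp hh,
      ((EuclideanSpace.proj (𝕜 := ℝ) j).integral_comp_comm hh).symm⟩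
  have hg : ∀ i, Measurable (g i) := by
    rintro (_ | j)
    · exact measurable_const
    · exact (EuclideanSpace.proj (𝕜 := ℝ) j).continuous.measurable
  have hgi : ∀ i, Integrable (g i) ν := by
    rintro (_ | j)
    · exact integrable_const _
    · exact (hproj j hν).1
  have hint : ∀ f : EuclideanSpace ℝ (Fin d) → ℝ, Measurable f →
      (∀ x, f x ∈ Set.Icc (0 : ℝ) 1) → Integrable (fun x => f x • x) ν := fun f hf hf01 =>
    hν.bdd_smul 1 hf.aestronglyMeasurable <| ae_norm_le_one_of_mem_Icc hf01
  have hcont : Continuous fun v : Option (Fin d) → ℝ => WithLp.toLp 2 fun j => v (some j) := by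
    fun_prop
  convert ((isCompact_setOf_integral_mul ν hg hgi).inter_right
    (isClosed_singleton.preimage (continuous_apply none) :
      IsClosed {v : Option (Fin d) → ℝ | v none ∈ ({1} : Set ℝ)})).image hcont using 1
  ext y
  constructor
  · rintro ⟨f, hf, hf01, hfi, hf1, rfl⟩
    refine ⟨fun i => ∫ x, f x * g i x ∂ν, ⟨⟨f, hf, hf01, fun i => rfl⟩, ?_⟩, ?_⟩
    · simpa [g] using hf1
    · ext j
      simp [(hproj j hfi).2, g]
  · rintro ⟨v, ⟨⟨f, hf, hf01, hv⟩, hv1⟩, rfl⟩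
    refine ⟨f, hf, hf01, hint f hf hf01, ?_, ?_⟩
    · simpa [hv, g] using hv1
    · ext j
      simp [(hproj j (hint f hf hf01)).2, g, hv]

theorem quantile_le_iff (ν : Measure ℝ) [IsProbabilityMeasure ν] {t : ℝ}
    (ht : t ∈ Set.Ioo (0 : ℝ) 1) (s : ℝ) : quantile ν t ≤ s ↔ t ≤ ν.real (Set.Iic s) := by
  have hset : {s : ℝ | t ≤ (ν (Set.Iic s)).toReal} = {s | t ≤ ProbabilityTheory.cdf ν s} := by
    ext s
    rw [Set.mem_ofPred_eq, Set.mem_ofPred_eq, ProbabilityTheory.cdf_eq_real]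
    rfl
  have hne : {s : ℝ | t ≤ ProbabilityTheory.cdf ν s}.Nonempty :=
    ((ProbabilityTheory.tendsto_cdf_atTop ν).eventually_const_le ht.2).exists
  have hbdd : BddBelow {s : ℝ | t ≤ ProbabilityTheory.cdf ν s} := by
    obtain ⟨b, hb⟩ :=
      ((ProbabilityTheory.tendsto_cdf_atBot ν).eventually_lt_const ht.1).exists
    refine ⟨b, fun s hs => le_of_not_gt fun hsb => ?_⟩
    exact (hs.trans (ProbabilityTheory.monotone_cdf ν hsb.le)).not_gt hb
  rw [quantile, hset, ← ProbabilityTheory.cdf_eq_real]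
  refine ⟨fun h => ?_, fun h => csInf_le hbdd h⟩
  refine ge_of_tendsto (((ProbabilityTheory.cdf ν).right_continuous s).mono_left
    (nhdsWithin_mono s Set.Ioi_subset_Ici_self)) ?_
  filter_upwards [self_mem_nhdsWithin] with s' hs'
  obtain ⟨r, hr, hrs⟩ := exists_lt_of_csInf_lt hne (h.trans_lt hs')
  exact hr.trans (ProbabilityTheory.monotone_cdf ν hrs.le)

theorem monotoneOn_quantile (ν : Measure ℝ) [IsProbabilityMeasure ν] :
    MonotoneOn (quantile ν) (Set.Ioo 0 1) := fun _ hs _ ht hst =>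
  (quantile_le_iff ν hs _).2 (hst.trans ((quantile_le_iff ν ht _).1 le_rfl))

theorem aemeasurable_quantile (ν : Measure ℝ) [IsProbabilityMeasure ν] :
    AEMeasurable (quantile ν) (volume.restrict (Set.Ioo 0 1)) :=
  aemeasurable_restrict_of_monotoneOn measurableSet_Ioo (monotoneOn_quantile ν)

theorem map_quantile (ν : Measure ℝ) [IsProbabilityMeasure ν] :
    (volume.restrict (Set.Ioo 0 1)).map (quantile ν) = ν := by
  symm
  refine Measure.ext_of_Iic _ _ fun a => ?_
  rw [Measure.map_apply_of_aemeasurable (aemeasurable_quantile ν) measurableSet_Iic]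
  have hpre : (volume.restrict (Set.Ioo 0 1)) (quantile ν ⁻¹' Set.Iic a) =
      (volume.restrict (Set.Ioo 0 1)) (Set.Iic (ν.real (Set.Iic a))) := by
    refine measure_congr ?_
    filter_upwards [ae_restrict_mem measurableSet_Ioo] with t ht
    exact propext (quantile_le_iff ν ht a)
  rw [hpre, Measure.restrict_congr_set Ioo_ae_eq_Ioc, Measure.restrict_apply measurableSet_Iic,
    Set.inter_comm, Set.Ioc_inter_Iic, inf_eq_right.2 measureReal_le_one, Real.volume_Ioc, sub_zero,
    ofReal_measureReal]

theorem integral_comp_quantile (ν : Measure ℝ) [IsProbabilityMeasure ν] {h : ℝ → ℝ}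
    (hh : Measurable h) : ∫ t in Set.Ioo 0 1, h (quantile ν t) = ∫ s, h s ∂ν := by
  conv_rhs => rw [← map_quantile ν]
  exact (integral_map (aemeasurable_quantile ν) hh.aestronglyMeasurable).symm

theorem integrableOn_quantile (ν : Measure ℝ) [IsProbabilityMeasure ν] (hν : Integrable id ν) :
    IntegrableOn (quantile ν) (Set.Ioo 0 1) := by
  rw [← map_quantile ν] at hν
  exact (integrable_map_measure measurable_id.aestronglyMeasurable (aemeasurable_quantile ν)).1 hν

theorem avgQuantile_eq_add_integral_max (ν : Measure ℝ) [IsProbabilityMeasure ν]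
    (hν : Integrable id ν) {α : ℝ} (hα : α ∈ Set.Ioo (0 : ℝ) 1) :
    avgQuantile ν α = quantile ν (1 - α) +
      α⁻¹ * ∫ s, max (s - quantile ν (1 - α)) 0 ∂ν := by
  have hα' : 1 - α ∈ Set.Ioo (0 : ℝ) 1 := ⟨by linarith [hα.2], by linarith [hα.1]⟩
  have hsub : Set.Ioo (1 - α) 1 ⊆ Set.Ioo 0 1 := Set.Ioo_subset_Ioo_left hα'.1.le
  set q := quantile ν (1 - α)
  have hmax : ∫ s, max (s - q) 0 ∂ν = ∫ t in Set.Ioo (1 - α) 1, (quantile ν t - q) := by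
    rw [← integral_comp_quantile ν (h := fun s => max (s - q) 0) (by fun_prop),
      ← Set.inter_eq_right.2 hsub, ← setIntegral_indicator measurableSet_Ioo]
    refine setIntegral_congr_fun measurableSet_Ioo fun t ht => ?_
    by_cases h : 1 - α < t
    · rw [Set.indicator_of_mem (show t ∈ Set.Ioo (1 - α) 1 from ⟨h, ht.2⟩)]
      exact max_eq_left (sub_nonneg.2 (monotoneOn_quantile ν hα' ht h.le))
    · rw [Set.indicator_of_notMem fun h' => h h'.1]
      exact max_eq_right (sub_nonpos.2 (monotoneOn_quantile ν ht hα' (not_lt.1 h)))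
  rw [hmax, integral_sub ((integrableOn_quantile ν hν).mono_set hsub) (by simp), avgQuantile,
    integral_Ioc_eq_integral_Ioo]
  have := hα.1.ne'
  simp [hα.1.le]
  field_simp
  ring

theorem avgQuantile_one (ν : Measure ℝ) [IsProbabilityMeasure ν] :
    avgQuantile ν 1 = ∫ s, s ∂ν := by
  rw [avgQuantile, integral_Ioc_eq_integral_Ioo, ← integral_comp_quantile ν measurable_id']
  simp

theorem measureReal_Iio_quantile_le (ν : Measure ℝ) [IsProbabilityMeasure ν] {t : ℝ}
    (ht : t ∈ Set.Ioo (0 : ℝ) 1) : ν.real (Set.Iio (quantile ν t)) ≤ t := by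
  refine ENNReal.toReal_le_of_le_ofReal ht.1.le ?_
  calc ν (Set.Iio (quantile ν t))
      = ((volume.restrict (Set.Ioo 0 1)).map (quantile ν)) (Set.Iio (quantile ν t)) := by
        rw [map_quantile]
    _ = (volume.restrict (Set.Ioo 0 1)) (quantile ν ⁻¹' Set.Iio (quantile ν t)) :=
        Measure.map_apply_of_aemeasurable (aemeasurable_quantile ν) measurableSet_Iio
    _ ≤ (volume.restrict (Set.Ioo 0 1)) (Set.Iio t) := by
        refine measure_mono_ae ?_
        filter_upwards [ae_restrict_mem measurableSet_Ioo] with r hr hrt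
        exact lt_of_not_ge fun h => (monotoneOn_quantile ν ht hr h).not_gt hrt
    _ = ENNReal.ofReal t := by
        rw [Measure.restrict_apply measurableSet_Iio, Set.inter_comm, Set.Ioo_inter_Iio,
          min_eq_right ht.2.le, Real.volume_Ioo, sub_zero]

theorem exists_unitInterval_valued_integral_eq {ν : Measure ℝ} [IsProbabilityMeasure ν] {α : ℝ}
    (hα : α ∈ Set.Ioo (0 : ℝ) 1) :
    ∃ f : ℝ → ℝ, Measurable f ∧ (∀ x, f x ∈ Set.Icc (0 : ℝ) 1) ∧ ∫ s, f s ∂ν = α ∧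
      ∀ s, (s - quantile ν (1 - α)) * f s = max (s - quantile ν (1 - α)) 0 := by
  have hα' : 1 - α ∈ Set.Ioo (0 : ℝ) 1 := ⟨by linarith [hα.2], by linarith [hα.1]⟩
  set q := quantile ν (1 - α)
  set a := ν.real (Set.Ioi q)
  set b := ν.real {q}
  have hIio : ν.real (Set.Iio q) ≤ 1 - α := measureReal_Iio_quantile_le ν hα'
  have hIic : 1 - α ≤ ν.real (Set.Iic q) := (quantile_le_iff ν hα' _).1 le_rfl
  have ha : a = 1 - ν.real (Set.Iic q) := by
    rw [← probReal_compl_eq_one_sub measurableSet_Iic, Set.compl_Iic]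
  have hb : ν.real (Set.Iic q) = ν.real (Set.Iio q) + b := by
    rw [← Set.Iio_union_right, measureReal_union (by simp) (measurableSet_singleton q)]
  have hb0 : 0 ≤ b := measureReal_nonneg
  obtain ⟨c, hc, hcb⟩ : ∃ c ∈ Set.Icc (0 : ℝ) 1, c * b = α - a := by
    rcases hb0.eq_or_lt with h | h
    · exact ⟨0, by simp, by linarith⟩
    · exact ⟨(α - a) / b, ⟨div_nonneg (by linarith) hb0, (div_le_one h).2 (by linarith)⟩,
        div_mul_cancel₀ _ h.ne'⟩
  refine ⟨fun s => (Set.Ioi q).indicator 1 s + ({q} : Set ℝ).indicator (fun _ => c) s,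
    ?_, fun s => ?_, ?_, fun s => ?_⟩
  · exact (measurable_one.indicator measurableSet_Ioi).add
      (measurable_const.indicator (measurableSet_singleton q))
  · rcases lt_trichotomy s q with h | rfl | h
    · simp [h.ne, h.le]
    · simpa using hc
    · simp [h.ne', h]
  · rw [integral_add ((integrable_const _).indicator measurableSet_Ioi)
      ((integrable_const _).indicator (measurableSet_singleton q)),
      integral_indicator_one measurableSet_Ioi,
      integral_indicator_const _ (measurableSet_singleton q), smul_eq_mul, mul_comm, hcb]
    ring
  · rcases lt_trichotomy s q with h | rfl | h
    · simp [h.ne, h.le]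
    · simp
    · simp [h.ne', h, h.le]

theorem isGreatest_avgQuantile {X : Type*} [MeasurableSpace X] (μ : Measure X)
    [IsProbabilityMeasure μ] {β : X → ℝ} (hβ : Measurable β) (hβi : Integrable β μ) {α : ℝ}
    (hα : α ∈ Set.Ioc (0 : ℝ) 1) :
    IsGreatest {r : ℝ | ∃ f : X → ℝ, Measurable f ∧ (∀ x, f x ∈ Set.Icc (0 : ℝ) 1) ∧
      (∫ x, f x ∂(ENNReal.ofReal α⁻¹ • μ)) = 1 ∧
      r = ∫ x, β x * f x ∂(ENNReal.ofReal α⁻¹ • μ)} (avgQuantile (μ.map β) α) := by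
  have hα0 : 0 < α := hα.1
  have : IsProbabilityMeasure (μ.map β) := Measure.isProbabilityMeasure_map hβ.aemeasurable
  have hid : Integrable id (μ.map β) :=
    (integrable_map_measure measurable_id.aestronglyMeasurable hβ.aemeasurable).2 hβi
  have hfi : ∀ {f : X → ℝ}, Measurable f → (∀ x, f x ∈ Set.Icc (0 : ℝ) 1) → Integrable f μ :=
    fun hf hf01 => Integrable.of_bound hf.aestronglyMeasurable 1 (ae_norm_le_one_of_mem_Icc hf01)
  have hscale : ∀ h : X → ℝ, ∫ x, h x ∂(ENNReal.ofReal α⁻¹ • μ) = α⁻¹ * ∫ x, h x ∂μ := by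
    intro h
    rw [integral_smul_measure, ENNReal.toReal_ofReal (inv_nonneg.2 hα0.le), smul_eq_mul]
  have hone : ∀ c : ℝ, α⁻¹ * c = 1 ↔ c = α := fun c => inv_mul_eq_one₀ hα0.ne' |>.trans eq_comm
  simp only [hscale, hone]
  rcases hα.2.eq_or_lt with rfl | hα1
  · have hval : avgQuantile (μ.map β) 1 = ∫ x, β x ∂μ := by
      rw [avgQuantile_one, integral_map hβ.aemeasurable measurable_id'.aestronglyMeasurable]
    refine ⟨⟨fun _ => 1, measurable_const, by simp, by simp, by simp [hval]⟩, ?_⟩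
    rintro _ ⟨f, hf, hf01, hf1, rfl⟩
    have hae : (fun x => 1 - f x) =ᵐ[μ] 0 := by
      rw [← integral_eq_zero_iff_of_nonneg (fun x => sub_nonneg.2 (hf01 x).2)
        ((integrable_const _).sub (hfi hf hf01)), integral_sub (integrable_const _) (hfi hf hf01),
        hf1]
      simp
    rw [hval, inv_one, one_mul]
    refine (integral_congr_ae ?_).le
    filter_upwards [hae] with x hx
    rw [← sub_eq_zero.1 hx, mul_one]
  · have hα' : α ∈ Set.Ioo (0 : ℝ) 1 := ⟨hα0, hα1⟩
    have hval := avgQuantile_eq_add_integral_max (μ.map β) hid hα'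
    set q := quantile (μ.map β) (1 - α)
    rw [integral_map hβ.aemeasurable (by fun_prop)] at hval
    have hsplit : ∀ {f : X → ℝ}, Measurable f → (∀ x, f x ∈ Set.Icc (0 : ℝ) 1) →
        ∫ x, f x ∂μ = α → α⁻¹ * ∫ x, β x * f x ∂μ = q + α⁻¹ * ∫ x, (β x - q) * f x ∂μ := by
      intro f hf hf01 hf1
      simp only [sub_mul]
      rw [integral_sub (hβi.mul_bdd hf.aestronglyMeasurable (ae_norm_le_one_of_mem_Icc hf01))
        ((hfi hf hf01).const_mul q), integral_const_mul, hf1]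
      field_simp
      ring
    have hqi : Integrable (fun x => β x - q) μ := hβi.sub (integrable_const _)
    constructor
    · obtain ⟨f, hf, hf01, hf1, hfq⟩ := exists_unitInterval_valued_integral_eq
        (ν := μ.map β) hα'
      have hf1' : ∫ x, f (β x) ∂μ = α := by
        rw [← hf1, integral_map hβ.aemeasurable hf.aestronglyMeasurable]
      refine ⟨fun x => f (β x), hf.comp hβ, fun x => hf01 _, hf1', ?_⟩
      rw [hsplit (f := fun x => f (β x)) (hf.comp hβ) (fun x => hf01 _) hf1', hval]
      simp only [q, hfq]
    · rintro _ ⟨f, hf, hf01, hf1, rfl⟩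
      rw [hsplit hf hf01 hf1, hval]
      gcongr
      · exact hqi.mul_bdd hf.aestronglyMeasurable (ae_norm_le_one_of_mem_Icc hf01)
      · exact hqi.pos_part
      · intro x
        rcases le_total (β x - q) 0 with h | h
        · exact (mul_nonpos_of_nonpos_of_nonneg h (hf01 x).1).trans (le_max_right _ _)
        · exact (mul_le_of_le_one_right h (hf01 x).2).trans (le_max_left _ _)

theorem convex_metronoid {d : ℕ} (ν : Measure (EuclideanSpace ℝ (Fin d))) [IsFiniteMeasure ν] :
    Convex ℝ (metronoid ν) := by
  rintro _ ⟨f, hf, hf01, hfi, hf1, rfl⟩ _ ⟨g, hg, hg01, hgi, hg1, rfl⟩ a b ha hb hab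
  have hint : ∀ {h : EuclideanSpace ℝ (Fin d) → ℝ}, Measurable h →
      (∀ x, h x ∈ Set.Icc (0 : ℝ) 1) → Integrable h ν := fun {h} hh hh01 =>
    Integrable.of_bound hh.aestronglyMeasurable 1 <| ae_norm_le_one_of_mem_Icc hh01
  have hadd : (fun x => (a * f x + b * g x) • x) = fun x => a • f x • x + b • g x • x := by
    ext1 x
    simp only [add_smul, mul_smul]
  refine ⟨fun x => a * f x + b * g x, by fun_prop,
    fun x => convex_Icc 0 1 (hf01 x) (hg01 x) ha hb hab, ?_, ?_, ?_⟩
  · rw [hadd]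
    exact (hfi.smul a).add (hgi.smul b)
  · rw [integral_add ((hint hf hf01).const_mul a) ((hint hg hg01).const_mul b),
      integral_const_mul, integral_const_mul, hf1, hg1, mul_one, mul_one, hab]
  · rw [hadd, ← integral_smul, ← integral_smul]
    exact (integral_add (hfi.smul a) (hgi.smul b)).symm

/-- for an integrable probability measure `μ` on `ℝ^d` and `α ∈ (0,1]`, the
metronoid of `α⁻¹μ` equals the average quantile set of `μ`; equivalently, for every `u`,
`sup {∫ ⟨x,u⟩ f(x) (α⁻¹μ)(dx) : f : ℝ^d → [0,1] measurable, ∫ f d(α⁻¹μ) = 1}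
  = e_α(⟨ξ,u⟩)` where `ξ` is distributed according to `μ`. -/
theorem statement7
    {d : ℕ} (μ : Measure (EuclideanSpace ℝ (Fin d))) [IsProbabilityMeasure μ]
    (hμint : Integrable (fun x => x) μ)
    (α : ℝ) (hα : α ∈ Set.Ioc (0:ℝ) 1) :
    metronoid (ENNReal.ofReal α⁻¹ • μ) = avgQuantileSet μ α ∧
    (∀ u : EuclideanSpace ℝ (Fin d),
      sSup {r : ℝ | ∃ f : EuclideanSpace ℝ (Fin d) → ℝ, Measurable f ∧
          (∀ x, f x ∈ Set.Icc (0:ℝ) 1) ∧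
          (∫ x, f x ∂(ENNReal.ofReal α⁻¹ • μ)) = 1 ∧
          r = ∫ x, ⟪x, u⟫ * f x ∂(ENNReal.ofReal α⁻¹ • μ)} =
        avgQuantile (Measure.map (fun v => ⟪v, u⟫) μ) α) := by
  have hfin : IsFiniteMeasure (ENNReal.ofReal α⁻¹ • μ) :=
    μ.smul_finite ENNReal.ofReal_ne_top
  have hint : Integrable (fun x => x) (ENNReal.ofReal α⁻¹ • μ) :=
    hμint.smul_measure ENNReal.ofReal_ne_top
  have hgreatest := fun u : EuclideanSpace ℝ (Fin d) =>
    isGreatest_avgQuantile μ (β := fun v => ⟪v, u⟫) (by fun_prop) (hμint.inner_const u) hα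
  have hinner : ∀ {f : EuclideanSpace ℝ (Fin d) → ℝ} (u : EuclideanSpace ℝ (Fin d)),
      Integrable (fun x => f x • x) (ENNReal.ofReal α⁻¹ • μ) →
      ⟪∫ x, f x • x ∂(ENNReal.ofReal α⁻¹ • μ), u⟫ =
        ∫ x, ⟪x, u⟫ * f x ∂(ENNReal.ofReal α⁻¹ • μ) := by
    intro f u hf
    rw [real_inner_comm, ← integral_inner hf]
    simp only [real_inner_smul_right, real_inner_comm u, mul_comm]
  refine ⟨Set.Subset.antisymm ?_ ?_, fun u => (hgreatest u).csSup_eq⟩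
  · rintro _ ⟨f, hf, hf01, hfi, hf1, rfl⟩ u
    exact (hgreatest u).2 ⟨f, hf, hf01, hf1, hinner u hfi⟩
  · intro y hy
    by_contra hy'
    obtain ⟨L, s, hL, hLy⟩ := geometric_hahn_banach_closed_point (convex_metronoid _)
      (isCompact_metronoid _ hint).isClosed hy'
    set u := (InnerProductSpace.toDual ℝ (EuclideanSpace ℝ (Fin d))).symm L
    have hLu : ∀ z, L z = ⟪z, u⟫ := fun z => by
      rw [real_inner_comm, InnerProductSpace.toDual_symm_apply]
    obtain ⟨f, hf, hf01, hf1, hfu⟩ := (hgreatest u).1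
    have hfi : Integrable (fun x => f x • x) (ENNReal.ofReal α⁻¹ • μ) :=
      hint.bdd_smul 1 hf.aestronglyMeasurable <| ae_norm_le_one_of_mem_Icc hf01
    have hlt := hL _ ⟨f, hf, hf01, hfi, hf1, rfl⟩
    rw [hLu, hinner u hfi, ← hfu] at hlt
    exact (hlt.trans (hLu y ▸ hLy)).not_ge (hy u)
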